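/- Suppose (x*, y*) ∈ Ω, i.e., x* ∈ C, y* ∈ Q and Ax* = By*. If x ∈ H₁ and y ∈ H₂ satisfy (I − P_C)x + A*(Ax − By) = 0 and (I − P_Q)y − B*(Ax − By) = 0, then ‖x − P_C x‖² + ‖y − P_Q y‖² + ‖Ax − By‖² ≤ 0; in particular x ∈ C, y ∈ Q and Ax = By. -/

import Mathlib

open RealInnerProductSpace

/-- If the angle at `p` between `x - p` and `z - p` is obtuse, then
`‖x - p‖² ≤ ⟨x - p, x - z⟩`. -/
theorem norm_sub_sq_le_inner_of_inner_nonpos {H : Type*} [NormedAddCommGroup H]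
    [InnerProductSpace ℝ H] {x p z : H} (h : inner ℝ (x - p) (z - p) ≤ 0) :
    ‖x - p‖ ^ 2 ≤ inner ℝ (x - p) (x - z) := by
  have hsplit : x - z = (x - p) - (z - p) := by abel
  rw [hsplit, inner_sub_right, real_inner_self_eq_norm_sq]
  linarith

theorem eq_of_norm_sub_sq_nonpos {H : Type*} [NormedAddCommGroup H] {u v : H}
    (h : ‖u - v‖ ^ 2 ≤ 0) : u = v :=
  sub_eq_zero.mp (norm_eq_zero.mp (sq_nonpos_iff _ |>.mp h))

/-- If (x*, y*) ∈ Ω and (x, y) solves the fixed-point equations, then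
‖x − P_C x‖² + ‖y − P_Q y‖² + ‖Ax − By‖² ≤ 0; in particular x ∈ C, y ∈ Q, Ax = By. -/
theorem fixed_point_solves_sep
    {H₁ H₂ H₃ : Type*}
    [NormedAddCommGroup H₁] [InnerProductSpace ℝ H₁] [CompleteSpace H₁]
    [NormedAddCommGroup H₂] [InnerProductSpace ℝ H₂] [CompleteSpace H₂]
    [NormedAddCommGroup H₃] [InnerProductSpace ℝ H₃] [CompleteSpace H₃]
    (C : Set H₁) (Q : Set H₂)
    (hCne : C.Nonempty) (hCclosed : IsClosed C) (hCconv : Convex ℝ C)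
    (hQne : Q.Nonempty) (hQclosed : IsClosed Q) (hQconv : Convex ℝ Q)
    (A : H₁ →L[ℝ] H₃) (B : H₂ →L[ℝ] H₃)
    (PC : H₁ → H₁) (hPC_mem : ∀ x, PC x ∈ C)
    (hPC : ∀ x, ∀ z ∈ C, ⟪x - PC x, z - PC x⟫ ≤ 0)
    (PQ : H₂ → H₂) (hPQ_mem : ∀ y, PQ y ∈ Q)
    (hPQ : ∀ y, ∀ z ∈ Q, ⟪y - PQ y, z - PQ y⟫ ≤ 0)
    (xs : H₁) (ys : H₂) (hxs : xs ∈ C) (hys : ys ∈ Q) (hAB : A xs = B ys)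
    (x : H₁) (y : H₂)
    (hx : (x - PC x) + (ContinuousLinearMap.adjoint A) (A x - B y) = 0)
    (hy : (y - PQ y) - (ContinuousLinearMap.adjoint B) (A x - B y) = 0) :
    ‖x - PC x‖ ^ 2 + ‖y - PQ y‖ ^ 2 + ‖A x - B y‖ ^ 2 ≤ 0 ∧
      x ∈ C ∧ y ∈ Q ∧ A x = B y := by
  have hp := norm_sub_sq_le_inner_of_inner_nonpos (hPC x xs hxs)
  have hq := norm_sub_sq_le_inner_of_inner_nonpos (hPQ y ys hys)
  have hpA : inner ℝ (x - PC x) (x - xs) = -inner ℝ (A x - B y) (A x - A xs) := by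
    rw [eq_neg_of_add_eq_zero_left hx, inner_neg_left, ContinuousLinearMap.adjoint_inner_left,
      map_sub]
  have hqB : inner ℝ (y - PQ y) (y - ys) = inner ℝ (A x - B y) (B y - B ys) := by
    rw [sub_eq_zero.mp hy, ContinuousLinearMap.adjoint_inner_left, map_sub]
  have hr : inner ℝ (A x - B y) (A x - A xs) - inner ℝ (A x - B y) (B y - B ys)
      = ‖A x - B y‖ ^ 2 := by
    rw [← inner_sub_right, hAB, sub_sub_sub_cancel_right, real_inner_self_eq_norm_sq]
  have hsum : ‖x - PC x‖ ^ 2 + ‖y - PQ y‖ ^ 2 + ‖A x - B y‖ ^ 2 ≤ 0 := by linarith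
  have hp0 := sq_nonneg ‖x - PC x‖
  have hq0 := sq_nonneg ‖y - PQ y‖
  have hr0 := sq_nonneg ‖A x - B y‖
  refine ⟨hsum, ?_, ?_, eq_of_norm_sub_sq_nonpos (by linarith)⟩
  · rw [eq_of_norm_sub_sq_nonpos (u := x) (v := PC x) (by linarith)]
    exact hPC_mem x
  · rw [eq_of_norm_sub_sq_nonpos (u := y) (v := PQ y) (by linarith)]
    exact hPQ_mem y
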